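/- arXiv:1807.07567 — 7 statements merged into one kernel-verified Lean document; each statement's English description precedes it below -/
import Mathlib

section
/- Let (h, v) be a 15-vertex configuration on ℤ², and define the level of the horizontal edge h (x, y) and of the vertical edge v (x, y) to be x + y. If the configuration has at least one unoriented edge, then for every integer n there exists an unoriented edge (horizontal or vertical) of level n. -/
/-- Number of oriented incident edges pointing into the vertex, where
`W E S N` are the west, east, south and north incident edges. -/
def din (W E S N : Option Bool) : ℕ :=
  (if W = some true then 1 else 0) + (if E = some false then 1 else 0) +
    (if S = some true then 1 else 0) + (if N = some false then 1 else 0)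

/-- Number of oriented incident edges pointing out of the vertex. -/
def dout (W E S N : Option Bool) : ℕ :=
  (if W = some false then 1 else 0) + (if E = some true then 1 else 0) +
    (if S = some false then 1 else 0) + (if N = some true then 1 else 0)

/-- The set of unoriented incident edges is ∅, {W,E}, {S,N}, {W,N}, {S,E} or all four. -/
def BlankOK (W E S N : Option Bool) : Prop :=
  (W ≠ none ∧ E ≠ none ∧ S ≠ none ∧ N ≠ none) ∨
  (W = none ∧ E = none ∧ S ≠ none ∧ N ≠ none) ∨
  (W ≠ none ∧ E ≠ none ∧ S = none ∧ N = none) ∨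
  (W = none ∧ E ≠ none ∧ S ≠ none ∧ N = none) ∨
  (W ≠ none ∧ E = none ∧ S = none ∧ N ≠ none) ∨
  (W = none ∧ E = none ∧ S = none ∧ N = none)

/-- `(h, v)` is a 15-vertex configuration on ℤ²: at every vertex `(x, y)` the
incident edges `W = h (x-1, y)`, `E = h (x, y)`, `S = v (x, y-1)`, `N = v (x, y)`
satisfy the 15-vertex rule. -/
def Fifteen (h v : ℤ × ℤ → Option Bool) : Prop :=
  ∀ x y : ℤ,
    din (h (x - 1, y)) (h (x, y)) (v (x, y - 1)) (v (x, y)) =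
      dout (h (x - 1, y)) (h (x, y)) (v (x, y - 1)) (v (x, y)) ∧
    BlankOK (h (x - 1, y)) (h (x, y)) (v (x, y - 1)) (v (x, y))

/-- If a 15-vertex configuration has at least one unoriented edge, then for every
integer `n` there is an unoriented edge of level `n`, where the level of the
edge `h (x, y)` or `v (x, y)` is `x + y`. -/
theorem stmt2 (h v : ℤ × ℤ → Option Bool) (hc : Fifteen h v)
    (hne : ∃ x y : ℤ, h (x, y) = none ∨ v (x, y) = none) (n : ℤ) :
    ∃ x y : ℤ, x + y = n ∧ (h (x, y) = none ∨ v (x, y) = none) := by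
  obtain ⟨a, b, hab⟩ := hne
  have up : ∀ m : ℤ, (∃ x y : ℤ, x + y = m ∧ (h (x, y) = none ∨ v (x, y) = none)) →
      ∃ x y : ℤ, x + y = m + 1 ∧ (h (x, y) = none ∨ v (x, y) = none) := by
    rintro m ⟨x, y, hm, hx | hx⟩
    · refine ⟨x + 1, y, by omega, ?_⟩
      have hb := (hc (x + 1) y).2
      rw [add_sub_cancel_right] at hb
      unfold BlankOK at hb
      tauto
    · refine ⟨x, y + 1, by omega, ?_⟩
      have hb := (hc x (y + 1)).2
      rw [add_sub_cancel_right] at hb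
      unfold BlankOK at hb
      tauto
  have down : ∀ m : ℤ, (∃ x y : ℤ, x + y = m ∧ (h (x, y) = none ∨ v (x, y) = none)) →
      ∃ x y : ℤ, x + y = m - 1 ∧ (h (x, y) = none ∨ v (x, y) = none) := by
    rintro m ⟨x, y, hm, hx⟩
    have hb := (hc x y).2
    have key : h (x - 1, y) = none ∨ v (x, y - 1) = none := by
      unfold BlankOK at hb
      tauto
    rcases key with k | k
    · exact ⟨x - 1, y, by omega, Or.inl k⟩
    · exact ⟨x, y - 1, by omega, Or.inr k⟩
  have main : ∀ k : ℤ, ∃ x y : ℤ, x + y = a + b + k ∧ (h (x, y) = none ∨ v (x, y) = none) := by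
    intro k
    induction k using Int.induction_on with
    | zero => exact ⟨a, b, by omega, hab⟩
    | succ k ih => simpa only [add_assoc] using up _ ih
    | pred k ih => simpa only [add_sub_assoc] using down _ ih
  have hn := main (n - (a + b))
  rwa [add_sub_cancel] at hn
end

section
/- Let (h, v) be a 15-vertex configuration on ℤ². If the set of unoriented edges (i.e. the set of pairs (x, y) with h (x, y) = none together with the set of pairs (x, y) with v (x, y) = none) is finite, then it is empty; that is, every edge is oriented, so (h, v) is a six-vertex configuration. -/
/-- If the set of unoriented edges (horizontal ones tagged by `Sum.inl`,
vertical ones by `Sum.inr`) of a 15-vertex configuration is finite, then it is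
empty: every edge is oriented, i.e. `(h, v)` is a six-vertex configuration. -/
theorem stmt3 (h v : ℤ × ℤ → Option Bool) (hc : Fifteen h v)
    (hfin : (Sum.inl '' {p : ℤ × ℤ | h p = none} ∪
      Sum.inr '' {p : ℤ × ℤ | v p = none} : Set ((ℤ × ℤ) ⊕ (ℤ × ℤ))).Finite) :
    ∀ p : ℤ × ℤ, h p ≠ none ∧ v p ≠ none := by
  -- Leaving a vertex north or east from a blank edge stays on a blank edge; `x + y` increases.
  have key : ∀ W E S N : Option Bool, BlankOK W E S N → (W = none ∨ S = none) →
      (E = none ∨ N = none) := by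
    intro W E S N hb
    unfold BlankOK at hb
    tauto
  have hh : ∀ x y : ℤ, h (x, y) = none → h (x + 1, y) = none ∨ v (x + 1, y) = none := by
    intro x y hxy
    refine key _ _ _ _ (hc (x + 1) y).2 (Or.inl ?_)
    simpa using hxy
  have hv : ∀ x y : ℤ, v (x, y) = none → h (x, y + 1) = none ∨ v (x, y + 1) = none := by
    intro x y hxy
    refine key _ _ _ _ (hc x (y + 1)).2 (Or.inr ?_)
    simpa using hxy
  have hF : ({p : ℤ × ℤ | h p = none ∨ v p = none}).Finite := by
    have h1 := Set.Finite.of_finite_image (hfin.subset Set.subset_union_left)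
      Sum.inl_injective.injOn
    have h2 := Set.Finite.of_finite_image (hfin.subset Set.subset_union_right)
      Sum.inr_injective.injOn
    exact h1.union h2
  by_contra hcon
  have hne : ({p : ℤ × ℤ | h p = none ∨ v p = none}).Nonempty := by
    by_contra hn
    apply hcon
    intro p
    refine ⟨fun hp => hn ⟨p, Or.inl hp⟩, fun hp => hn ⟨p, Or.inr hp⟩⟩
  obtain ⟨⟨x, y⟩, hp, hmax⟩ := Set.exists_max_image _ (fun p : ℤ × ℤ => p.1 + p.2) hF hne
  rcases hp with hp | hp
  · have := hmax (x + 1, y) (hh x y hp)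
    simp only at this
    omega
  · have := hmax (x, y + 1) (hv x y hp)
    simp only at this
    omega
end

section
/- Let n ≥ 1 and let (h, v) be a 15-vertex configuration on ℤ². Suppose every edge having at least one endpoint (a, b) with 0 ≤ a ≤ n, 0 ≤ b ≤ n, and (a = 0 or a = n or b = 0 or b = n) is oriented (not equal to none). Then every edge both of whose endpoints (a, b) satisfy 0 < a < n and 0 < b < n is oriented. In particular, under the domain wall boundary condition (where all boundary edges carry arrows) the 15-vertex configurations of the square domain coincide with the six-vertex configurations. -/
/-- `p` is a boundary lattice point of the square domain `[0, n] × [0, n]`. -/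
def OnBoundary (n : ℤ) (p : ℤ × ℤ) : Prop :=
  0 ≤ p.1 ∧ p.1 ≤ n ∧ 0 ≤ p.2 ∧ p.2 ≤ n ∧ (p.1 = 0 ∨ p.1 = n ∨ p.2 = 0 ∨ p.2 = n)

/-- `p` is an interior lattice point of the square domain `[0, n] × [0, n]`. -/
def InInterior (n : ℤ) (p : ℤ × ℤ) : Prop :=
  0 < p.1 ∧ p.1 < n ∧ 0 < p.2 ∧ p.2 < n

/-- If in a 15-vertex configuration every edge with an endpoint on the boundary
of the square `[0, n] × [0, n]` is oriented, then every edge with both endpoints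
in the interior of the square is oriented; in particular, under DWBC the
15-vertex configurations of the square coincide with six-vertex configurations. -/
theorem stmt4 (n : ℤ) (hn : 1 ≤ n) (h v : ℤ × ℤ → Option Bool) (hc : Fifteen h v)
    (hbh : ∀ x y : ℤ, (OnBoundary n (x, y) ∨ OnBoundary n (x + 1, y)) → h (x, y) ≠ none)
    (hbv : ∀ x y : ℤ, (OnBoundary n (x, y) ∨ OnBoundary n (x, y + 1)) → v (x, y) ≠ none) :
    (∀ x y : ℤ, InInterior n (x, y) ∧ InInterior n (x + 1, y) → h (x, y) ≠ none) ∧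
    (∀ x y : ℤ, InInterior n (x, y) ∧ InInterior n (x, y + 1) → v (x, y) ≠ none) := by
  have key : ∀ a b : ℕ, (a : ℤ) ≤ n → (b : ℤ) ≤ n →
      h ((a : ℤ), (b : ℤ)) ≠ none ∧ v ((a : ℤ), (b : ℤ)) ≠ none := by
    intro a
    induction a with
    | zero =>
      intro b ha hb
      have hB : OnBoundary n (((0 : ℕ) : ℤ), (b : ℤ)) := by
        simp only [OnBoundary]; omega
      exact ⟨hbh _ _ (Or.inl hB), hbv _ _ (Or.inl hB)⟩
    | succ a iha =>
      intro b
      induction b with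
      | zero =>
        intro ha hb
        have hB : OnBoundary n (((a + 1 : ℕ) : ℤ), ((0 : ℕ) : ℤ)) := by
          simp only [OnBoundary]; omega
        exact ⟨hbh _ _ (Or.inl hB), hbv _ _ (Or.inl hB)⟩
      | succ b ihb =>
        intro ha hb
        have h1 := (iha (b + 1) (by omega) hb).1
        have h2 := (ihb ha (by omega)).2
        have hB := (hc ((a + 1 : ℕ) : ℤ) ((b + 1 : ℕ) : ℤ)).2
        have e1 : ((a + 1 : ℕ) : ℤ) - 1 = a := by omega
        have e2 : ((b + 1 : ℕ) : ℤ) - 1 = b := by omega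
        rw [e1, e2] at hB
        unfold BlankOK at hB
        tauto
  constructor
  · rintro x y ⟨⟨h1, h2, h3, h4⟩, -⟩
    simp only at h1 h2 h3 h4
    lift x to ℕ using h1.le
    lift y to ℕ using h3.le
    exact (key x y h2.le h4.le).1
  · rintro x y ⟨⟨h1, h2, h3, h4⟩, -⟩
    simp only at h1 h2 h3 h4
    lift x to ℕ using h1.le
    lift y to ℕ using h3.le
    exact (key x y h2.le h4.le).2
end

section
/- Let (h, v) be a 15-vertex configuration on ℤ² and define δ : Option Bool → ℤ by δ (some true) = 1, δ (some false) = −1, δ none = 0. Then there exists a height function H : ℤ × ℤ → ℤ (indexed by the faces of ℤ²) such that for all (x, y): H (x+1, y) − H (x, y) = δ (v (x+1, y)) and H (x, y+1) − H (x, y) = − δ (h (x, y+1)). Moreover H is unique up to an additive constant: if H and H' both satisfy these difference equations, then H − H' is constant on ℤ × ℤ. -/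
/-- Height increment across an edge. -/
def delta : Option Bool → ℤ
  | some true => 1
  | some false => -1
  | none => 0

/-- `H` is a height function for the configuration `(h, v)`: `H (x, y)` is the
height of the unit face `[x, x+1] × [y, y+1]` and moving east across the
vertical edge `v (x+1, y)` (resp. north across the horizontal edge `h (x, y+1)`)
changes the height by `delta (v (x+1, y))` (resp. `- delta (h (x, y+1))`). -/
def IsHeight (h v : ℤ × ℤ → Option Bool) (H : ℤ × ℤ → ℤ) : Prop :=
  ∀ x y : ℤ,
    H (x + 1, y) - H (x, y) = delta (v (x + 1, y)) ∧
    H (x, y + 1) - H (x, y) = - delta (h (x, y + 1))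

/-- Every integer sequence has a discrete antiderivative vanishing at `0`. -/
theorem exists_antidiff (f : ℤ → ℤ) :
    ∃ G : ℤ → ℤ, G 0 = 0 ∧ ∀ n, G (n + 1) - G n = f n := by
  refine ⟨fun n => ∑ i ∈ Finset.range n.toNat, f i -
    ∑ i ∈ Finset.range (-n).toNat, f (-(i : ℤ) - 1), by simp, fun n => ?_⟩
  rcases le_or_gt 0 n with hn | hn
  · obtain ⟨k, rfl⟩ := Int.eq_ofNat_of_zero_le hn
    have h1 : ((k : ℤ) + 1).toNat = k + 1 := by omega
    have h2 : (-((k : ℤ) + 1)).toNat = 0 := by omega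
    have h3 : (-(k : ℤ)).toNat = 0 := by omega
    have h4 : (k : ℤ).toNat = k := by omega
    simp only [h1, h2, h3, h4, Finset.sum_range_succ, Finset.sum_range_zero]
    ring
  · obtain ⟨k, hk⟩ := Int.eq_ofNat_of_zero_le (show 0 ≤ -n - 1 by omega)
    obtain rfl : n = -(k : ℤ) - 1 := by omega
    have h1 : (-(k : ℤ) - 1 + 1).toNat = 0 := by omega
    have h2 : (-(-(k : ℤ) - 1 + 1)).toNat = k := by omega
    have h3 : (-(-(k : ℤ) - 1)).toNat = k + 1 := by omega
    have h4 : (-(k : ℤ) - 1).toNat = 0 := by omega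
    simp only [h1, h2, h3, h4, Finset.sum_range_succ, Finset.sum_range_zero]
    ring

/-- An integer sequence with zero increments is constant. -/
theorem const_of_step (f : ℤ → ℤ) (hf : ∀ n, f (n + 1) = f n) (n : ℤ) : f n = f 0 := by
  induction n using Int.induction_on with
  | zero => rfl
  | succ k ih => rw [hf, ih]
  | pred k ih =>
    have h1 := hf (-(k : ℤ) - 1)
    rw [sub_add_cancel] at h1
    rw [← h1, ih]

/-- Conservation of arrows at a vertex, in terms of `delta`. -/
theorem delta_conserve (W E S N : Option Bool) (hd : din W E S N = dout W E S N) :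
    delta W + delta S = delta E + delta N := by
  revert hd
  rcases W with _ | _ | _ <;> rcases E with _ | _ | _ <;> rcases S with _ | _ | _ <;>
    rcases N with _ | _ | _ <;> simp [din, dout, delta]

/-- Every 15-vertex configuration admits a height function, and the height
function is unique up to an additive constant. -/
theorem stmt5 (h v : ℤ × ℤ → Option Bool) (hc : Fifteen h v) :
    (∃ H : ℤ × ℤ → ℤ, IsHeight h v H) ∧
    (∀ H H' : ℤ × ℤ → ℤ, IsHeight h v H → IsHeight h v H' →
      ∃ c : ℤ, ∀ p : ℤ × ℤ, H p - H' p = c) := by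
  constructor
  · obtain ⟨A, -, hA⟩ := exists_antidiff (fun x => delta (v (x + 1, 0)))
    choose B hB0 hB using fun x : ℤ => exists_antidiff (fun y => - delta (h (x, y + 1)))
    refine ⟨fun p => A p.1 + B p.1 p.2, fun x y => ⟨?_, ?_⟩⟩
    · have key := const_of_step
        (fun y => A (x + 1) + B (x + 1) y - (A x + B x y) - delta (v (x + 1, y))) (fun n => by
          have h1 := delta_conserve _ _ _ _ (hc (x + 1) (n + 1)).1
          simp only [add_sub_cancel_right] at h1
          have h2 := hB x n
          have h3 := hB (x + 1) n
          linarith) y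
      have h0 := hA x
      simp only [hB0] at key h0 ⊢
      linarith
    · have h1 := hB x y
      simp only at h1 ⊢
      linarith
  · intro H H' hH hH'
    refine ⟨H (0, 0) - H' (0, 0), fun ⟨x, y⟩ => ?_⟩
    have h1 := const_of_step (fun n => H (n, y) - H' (n, y)) (fun n => by
      have a := (hH n y).1
      have b := (hH' n y).1
      linarith) x
    have h2 := const_of_step (fun n => H (0, n) - H' (0, n)) (fun n => by
      have a := (hH 0 n).2
      have b := (hH' 0 n).2
      linarith) y
    exact h1.trans h2
end

section
/- (Validity of action II, unidirectional loop reversal.) Let (h, v) be a 15-vertex configuration on ℤ² and suppose the four edges of the unit square with south-west corner (x, y) form a directed cycle; that is, there is a Boolean b with h (x, y) = some b, v (x+1, y) = some b, h (x, y+1) = some (¬b), v (x, y) = some (¬b). Define (h', v') by negating the Boolean values on exactly these four edges (h' (x, y) = some (¬b), v' (x+1, y) = some (¬b), h' (x, y+1) = some b, v' (x, y) = some b) and leaving all other edges unchanged. Then (h', v') is again a 15-vertex configuration, and its set of unoriented edges is identical to that of (h, v). -/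
/-- Validity of action II (unidirectional loop reversal): reversing a directed
cycle on the four edges of the unit square with south-west corner `(x, y)`
yields again a 15-vertex configuration with the same set of unoriented edges. -/
theorem stmt6 (h v h' v' : ℤ × ℤ → Option Bool) (hc : Fifteen h v)
    (x y : ℤ) (b : Bool)
    (hS : h (x, y) = some b) (hE : v (x + 1, y) = some b)
    (hN : h (x, y + 1) = some (!b)) (hW : v (x, y) = some (!b))
    (hh : ∀ p : ℤ × ℤ,
      h' p = if p = (x, y) then some (!b) else if p = (x, y + 1) then some b else h p)
    (hv : ∀ p : ℤ × ℤ,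
      v' p = if p = (x, y) then some b else if p = (x + 1, y) then some (!b) else v p) :
    Fifteen h' v' ∧
      {p : ℤ × ℤ | h' p = none} = {p : ℤ × ℤ | h p = none} ∧
      {p : ℤ × ℤ | v' p = none} = {p : ℤ × ℤ | v p = none} := by
  refine ⟨?_, ?_, ?_⟩
  · intro a c
    have H := hc a c
    simp only [hh, hv, Prod.mk.injEq]
    by_cases ha : a = x
    · subst ha
      by_cases h1 : c = y
      · subst h1
        simp [hS, hW] at H ⊢
        revert H
        generalize h (a - 1, c) = p
        generalize v (a, c - 1) = q
        clear * - b p q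
        rcases b with _ | _ <;> rcases p with _ | _ | _ <;> rcases q with _ | _ | _ <;>
          simp [din, dout, BlankOK]
      · by_cases h2 : c = y + 1
        · subst h2
          simp [hN, hW] at H ⊢
          revert H
          generalize h (a - 1, y + 1) = p
          generalize v (a, y + 1) = q
          clear * - b p q
          rcases b with _ | _ <;> rcases p with _ | _ | _ <;> rcases q with _ | _ | _ <;>
            simp [din, dout, BlankOK]
        · have h3 : ¬ c - 1 = y := by omega
          simpa [h1, h2, h3] using H
    · by_cases ha2 : a = x + 1
      · subst ha2
        by_cases h1 : c = y
        · subst h1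
          simp [hS, hE] at H ⊢
          revert H
          generalize h (x + 1, c) = p
          generalize v (x + 1, c - 1) = q
          clear * - b p q
          rcases b with _ | _ <;> rcases p with _ | _ | _ <;> rcases q with _ | _ | _ <;>
            simp [din, dout, BlankOK]
        · by_cases h2 : c = y + 1
          · subst h2
            simp [hN, hE] at H ⊢
            revert H
            generalize h (x + 1, y + 1) = p
            generalize v (x + 1, y + 1) = q
            clear * - b p q
            rcases b with _ | _ <;> rcases p with _ | _ | _ <;> rcases q with _ | _ | _ <;>
              simp [din, dout, BlankOK]
          · have h3 : ¬ c - 1 = y := by omega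
            simpa [h1, h2, h3] using H
      · have h3 : ¬ a - 1 = x := by omega
        simpa [ha, ha2, h3] using H
  · ext p
    simp only [Set.mem_ofPred_eq, hh]
    split_ifs with h1 h2
    · simp [h1, hS]
    · simp [h2, hN]
    · rfl
  · ext p
    simp only [Set.mem_ofPred_eq, hv]
    split_ifs with h1 h2
    · simp [h1, hW]
    · simp [h2, hE]
    · rfl
end

section
/- (Validity of action I, blank-corner flip.) Let (h, v) be a 15-vertex configuration on ℤ² and suppose that on the unit square with south-west corner (x, y) the south and east edges are unoriented and the west and north edges carry a directed path: h (x, y) = none, v (x+1, y) = none, and v (x, y) = some b, h (x, y+1) = some b for some Boolean b. Define (h', v') by h' (x, y) = some b, v' (x+1, y) = some b, v' (x, y) = none, h' (x, y+1) = none, all other edges unchanged. Then (h', v') is again a 15-vertex configuration, and its set of unoriented edges is obtained from that of (h, v) by removing the south and east edges of the square and adding its west and north edges; in particular the total number of unoriented edges is unchanged. -/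
/-- The local 15-vertex rule at one vertex. -/
def LocalRule (W E S N : Option Bool) : Prop :=
  din W E S N = dout W E S N ∧ BlankOK W E S N

instance (W E S N : Option Bool) : Decidable (LocalRule W E S N) := by
  unfold LocalRule BlankOK
  infer_instance

theorem local_sw : ∀ (b : Bool) (W S : Option Bool),
    LocalRule W none S (some b) → LocalRule W (some b) S none := by decide

theorem local_ne : ∀ (b : Bool) (E N : Option Bool),
    LocalRule (some b) E none N → LocalRule none E (some b) N := by decide

theorem local_nw : ∀ (b : Bool) (W N : Option Bool),
    LocalRule W (some b) (some b) N → LocalRule W none none N := by decide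

theorem local_se : ∀ (b : Bool) (E S : Option Bool),
    LocalRule none E S none → LocalRule (some b) E S (some b) := by decide

/-- Validity of action I (blank-corner flip): if on the unit square with
south-west corner `(x, y)` the south and east edges are unoriented and the west
and north edges carry a directed path, moving the blanks to the west and north
edges and the directed path to the south and east edges yields again a
15-vertex configuration; its set of unoriented edges is obtained by removing
the south and east edges and adding the west and north edges of the square, and
in particular the total number of unoriented edges is unchanged. -/
theorem stmt7 (h v h' v' : ℤ × ℤ → Option Bool) (hc : Fifteen h v)
    (x y : ℤ) (b : Bool)
    (hS : h (x, y) = none) (hE : v (x + 1, y) = none)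
    (hW : v (x, y) = some b) (hN : h (x, y + 1) = some b)
    (hh : ∀ p : ℤ × ℤ,
      h' p = if p = (x, y) then some b else if p = (x, y + 1) then none else h p)
    (hv : ∀ p : ℤ × ℤ,
      v' p = if p = (x, y) then none else if p = (x + 1, y) then some b else v p) :
    Fifteen h' v' ∧
      {p : ℤ × ℤ | h' p = none} =
        {p : ℤ × ℤ | h p = none} \ {(x, y)} ∪ {(x, y + 1)} ∧
      {p : ℤ × ℤ | v' p = none} =
        {p : ℤ × ℤ | v p = none} \ {(x + 1, y)} ∪ {(x, y)} ∧
      {p : ℤ × ℤ | h' p = none}.encard + {p : ℤ × ℤ | v' p = none}.encard =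
        {p : ℤ × ℤ | h p = none}.encard + {p : ℤ × ℤ | v p = none}.encard := by
  have e1 : {p : ℤ × ℤ | h' p = none} =
      {p : ℤ × ℤ | h p = none} \ {(x, y)} ∪ {(x, y + 1)} := by
    ext p
    simp only [Set.mem_setOf_eq, Set.mem_union, Set.mem_diff, Set.mem_singleton_iff, hh p]
    by_cases h1 : p = (x, y)
    · subst h1; simp
    · by_cases h2 : p = (x, y + 1) <;> simp [h1, h2]
  have e2 : {p : ℤ × ℤ | v' p = none} =
      {p : ℤ × ℤ | v p = none} \ {(x + 1, y)} ∪ {(x, y)} := by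
    ext p
    simp only [Set.mem_setOf_eq, Set.mem_union, Set.mem_diff, Set.mem_singleton_iff, hv p]
    by_cases h1 : p = (x, y)
    · simp [h1]
    · by_cases h2 : p = (x + 1, y) <;> simp [h1, h2]
  refine ⟨?_, e1, e2, ?_⟩
  · intro a c
    have key : LocalRule (h (a - 1, c)) (h (a, c)) (v (a, c - 1)) (v (a, c)) := hc a c
    change LocalRule (h' (a - 1, c)) (h' (a, c)) (v' (a, c - 1)) (v' (a, c))
    by_cases ha : a = x
    · subst ha
      by_cases hcy : c = y
      · subst hcy
        rw [hS, hW] at key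
        simpa [hh, hv] using local_sw b _ _ key
      · by_cases hcy' : c = y + 1
        · subst hcy'
          rw [hN, add_sub_cancel_right, hW] at key
          simpa [hh, hv] using local_nw b _ _ key
        · have : c - 1 ≠ y := by omega
          simpa [hh, hv, hcy, hcy', this] using key
    · by_cases ha' : a = x + 1
      · subst ha'
        by_cases hcy : c = y
        · subst hcy
          rw [add_sub_cancel_right, hS, hE] at key
          simpa [hh, hv] using local_se b _ _ key
        · by_cases hcy' : c = y + 1
          · subst hcy'
            rw [add_sub_cancel_right, add_sub_cancel_right, hN, hE] at key
            simpa [hh, hv] using local_ne b _ _ key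
          · have : c - 1 ≠ y := by omega
            simpa [hh, hv, hcy, hcy', this] using key
      · have : a - 1 ≠ x := by omega
        simpa [hh, hv, ha, ha', this] using key
  · rw [e1, e2, Set.union_singleton, Set.union_singleton,
      Set.encard_exchange (by simp [hN]) (by simp [hS]),
      Set.encard_exchange (by simp [hW]) (by simp [hE])]
end

section
/- (Conservation of unoriented edges, Proposition 2.) Call (h', v') an elementary move of (h, v) at the unit square with south-west corner (x, y) if it is obtained from (h, v) either by an action I flip there (blanks on the south and east edges together with a directed path on the west and north edges replaced by blanks on the west and north edges and the corresponding directed path on the south and east edges, or vice versa) or by an action II flip there (reversal of a directed cycle on the four edges of the square). If a 15-vertex configuration c' is obtained from a 15-vertex configuration c by a finite sequence of elementary moves, then, writing U(c) and U(c') for the sets of unoriented edges, the set differences U(c) \\ U(c') and U(c') \\ U(c) are finite and have equal cardinality. In particular, if c has finitely many unoriented edges, then c' has exactly as many. -/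
/-- A configuration: the pair of horizontal and vertical edge fields. -/
def Conf : Type := (ℤ × ℤ → Option Bool) × (ℤ × ℤ → Option Bool)

/-- The set of unoriented edges of a configuration (horizontal edges tagged by
`Sum.inl`, vertical ones by `Sum.inr`). -/
def Unor (c : Conf) : Set ((ℤ × ℤ) ⊕ (ℤ × ℤ)) :=
  Sum.inl '' {p : ℤ × ℤ | c.1 p = none} ∪ Sum.inr '' {p : ℤ × ℤ | c.2 p = none}

/-- Action I flip at the unit square with south-west corner `(x, y)`: blanks on
the south and east edges together with a directed path on the west and north
edges are replaced by blanks on the west and north edges and the corresponding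
directed path on the south and east edges, or vice versa; all other edges are
unchanged. -/
def ActionI (c c' : Conf) (x y : ℤ) : Prop :=
  (∃ b : Bool,
    (c.1 (x, y) = none ∧ c.2 (x + 1, y) = none ∧
        c.2 (x, y) = some b ∧ c.1 (x, y + 1) = some b ∧
      c'.1 (x, y) = some b ∧ c'.2 (x + 1, y) = some b ∧
        c'.2 (x, y) = none ∧ c'.1 (x, y + 1) = none) ∨
    (c.1 (x, y) = some b ∧ c.2 (x + 1, y) = some b ∧
        c.2 (x, y) = none ∧ c.1 (x, y + 1) = none ∧
      c'.1 (x, y) = none ∧ c'.2 (x + 1, y) = none ∧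
        c'.2 (x, y) = some b ∧ c'.1 (x, y + 1) = some b)) ∧
  (∀ p : ℤ × ℤ, p ≠ (x, y) → p ≠ (x, y + 1) → c'.1 p = c.1 p) ∧
  (∀ p : ℤ × ℤ, p ≠ (x, y) → p ≠ (x + 1, y) → c'.2 p = c.2 p)

/-- Action II flip at the unit square with south-west corner `(x, y)`: the
directed cycle on the four edges of the square is reversed; all other edges are
unchanged. -/
def ActionII (c c' : Conf) (x y : ℤ) : Prop :=
  (∃ b : Bool,
    c.1 (x, y) = some b ∧ c.2 (x + 1, y) = some b ∧
      c.1 (x, y + 1) = some (!b) ∧ c.2 (x, y) = some (!b) ∧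
    c'.1 (x, y) = some (!b) ∧ c'.2 (x + 1, y) = some (!b) ∧
      c'.1 (x, y + 1) = some b ∧ c'.2 (x, y) = some b) ∧
  (∀ p : ℤ × ℤ, p ≠ (x, y) → p ≠ (x, y + 1) → c'.1 p = c.1 p) ∧
  (∀ p : ℤ × ℤ, p ≠ (x, y) → p ≠ (x + 1, y) → c'.2 p = c.2 p)

/-- An elementary move: an action I or action II flip at some unit square. -/
def Move (c c' : Conf) : Prop := ∃ x y : ℤ, ActionI c c' x y ∨ ActionII c c' x y

/-- Two edge sets related by a finitely supported permutation. -/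
def PermRel (A B : Set ((ℤ × ℤ) ⊕ (ℤ × ℤ))) : Prop :=
  ∃ s : Equiv.Perm ((ℤ × ℤ) ⊕ (ℤ × ℤ)), {z | s z ≠ z}.Finite ∧ ∀ z, s z ∈ B ↔ z ∈ A

lemma PermRel.rfl' (A : Set ((ℤ × ℤ) ⊕ (ℤ × ℤ))) : PermRel A A :=
  ⟨1, by simp, by simp⟩

lemma PermRel.trans' {A B C : Set ((ℤ × ℤ) ⊕ (ℤ × ℤ))} (h1 : PermRel A B) (h2 : PermRel B C) :
    PermRel A C := by
  obtain ⟨s, hs, hs'⟩ := h1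
  obtain ⟨t, ht, ht'⟩ := h2
  refine ⟨t * s, (hs.union ht).subset ?_, fun z => ?_⟩
  · intro z hz
    by_contra hn
    simp only [Set.mem_union, Set.mem_setOf_eq, not_or, not_not] at hn
    apply hz
    simp [Equiv.Perm.mul_apply, hn.1, hn.2]
  · rw [Equiv.Perm.mul_apply, ht', hs']

lemma PermRel.concl {A B : Set ((ℤ × ℤ) ⊕ (ℤ × ℤ))} (h : PermRel A B) :
    (A \ B).Finite ∧ (B \ A).Finite ∧ (A \ B).ncard = (B \ A).ncard ∧
      (A.Finite → B.Finite ∧ B.ncard = A.ncard) := by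
  obtain ⟨s, hs, hs'⟩ := h
  set F := {z | s z ≠ z} with hF
  have hBA : B = s '' A := by
    ext z
    rw [Set.mem_image]
    constructor
    · intro hz
      exact ⟨s.symm z, by rw [← hs']; simpa using hz, by simp⟩
    · rintro ⟨w, hw, rfl⟩
      exact (hs' w).2 hw
  have key : ∀ z, z ∉ F → (z ∈ B ↔ z ∈ A) := by
    intro z hz
    have : s z = z := by simpa [hF] using hz
    rw [← hs' z, this]
  have himg : B ∩ F = s '' (A ∩ F) := by
    ext z
    rw [Set.mem_image]
    constructor
    · rintro ⟨hz, hzF⟩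
      refine ⟨s.symm z, ⟨by rw [← hs']; simpa using hz, ?_⟩, by simp⟩
      intro h
      apply hzF
      have h' : z = s.symm z := by simpa using h
      exact (Equiv.eq_symm_apply s).1 h'
    · rintro ⟨w, ⟨hw, hwF⟩, rfl⟩
      exact ⟨(hs' w).2 hw, fun h => hwF (s.injective h)⟩
  have hcard : (A ∩ F).ncard = (B ∩ F).ncard := by
    rw [himg, Set.ncard_image_of_injective _ s.injective]
  have e1 : A \ B = (A ∩ F) \ (B ∩ F) := by
    ext z
    have := key z
    simp only [Set.mem_diff, Set.mem_inter_iff]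
    tauto
  have e2 : B \ A = (B ∩ F) \ (A ∩ F) := by
    ext z
    have := key z
    simp only [Set.mem_diff, Set.mem_inter_iff]
    tauto
  have fA : (A ∩ F).Finite := hs.subset Set.inter_subset_right
  have fB : (B ∩ F).Finite := hs.subset Set.inter_subset_right
  refine ⟨e1 ▸ fA.diff, e2 ▸ fB.diff, ?_, fun hA => ?_⟩
  · rw [e1, e2]
    have h1 := Set.ncard_inter_add_ncard_diff_eq_ncard (A ∩ F) (B ∩ F) fA
    have h2 := Set.ncard_inter_add_ncard_diff_eq_ncard (B ∩ F) (A ∩ F) fB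
    rw [Set.inter_comm] at h2
    omega
  · rw [hBA]
    exact ⟨hA.image _, Set.ncard_image_of_injective _ s.injective⟩

lemma mem_Unor_inl (c : Conf) (p : ℤ × ℤ) : Sum.inl p ∈ Unor c ↔ c.1 p = none := by
  simp [Unor]

lemma mem_Unor_inr (c : Conf) (p : ℤ × ℤ) : Sum.inr p ∈ Unor c ↔ c.2 p = none := by
  simp [Unor]

lemma PermRel.of_move {c d : Conf} (h : Move c d) : PermRel (Unor c) (Unor d) := by
  obtain ⟨x, y, h | h⟩ := h
  · obtain ⟨⟨b, hb⟩, h1, h2⟩ := h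
    refine ⟨Equiv.sumCongr (Equiv.swap (x, y) (x, y + 1)) (Equiv.swap (x, y) (x + 1, y)), ?_, ?_⟩
    · refine (Set.toFinite ({Sum.inl (x, y), Sum.inl (x, y + 1), Sum.inr (x, y),
        Sum.inr (x + 1, y)} : Set ((ℤ × ℤ) ⊕ (ℤ × ℤ)))).subset ?_
      rintro (p | p) hp
      · by_contra hn
        simp only [Set.mem_insert_iff, Set.mem_singleton_iff, not_or, Sum.inl.injEq] at hn
        apply hp
        simp [Equiv.swap_apply_of_ne_of_ne hn.1 hn.2.1]
      · by_contra hn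
        simp only [Set.mem_insert_iff, Set.mem_singleton_iff, not_or, Sum.inr.injEq] at hn
        apply hp
        simp [Equiv.swap_apply_of_ne_of_ne hn.2.2.1 hn.2.2.2]
    · rintro (p | p)
      · simp only [Equiv.sumCongr_apply, Sum.map_inl, mem_Unor_inl]
        by_cases e1 : p = (x, y)
        · subst e1; rw [Equiv.swap_apply_left]; rcases hb with hb | hb <;> simp [hb]
        by_cases e2 : p = (x, y + 1)
        · subst e2; rw [Equiv.swap_apply_right]; rcases hb with hb | hb <;> simp [hb]
        rw [Equiv.swap_apply_of_ne_of_ne e1 e2, h1 p e1 e2]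
      · simp only [Equiv.sumCongr_apply, Sum.map_inr, mem_Unor_inr]
        by_cases e1 : p = (x, y)
        · subst e1; rw [Equiv.swap_apply_left]; rcases hb with hb | hb <;> simp [hb]
        by_cases e2 : p = (x + 1, y)
        · subst e2; rw [Equiv.swap_apply_right]; rcases hb with hb | hb <;> simp [hb]
        rw [Equiv.swap_apply_of_ne_of_ne e1 e2, h2 p e1 e2]
  · obtain ⟨⟨b, hb⟩, h1, h2⟩ := h
    refine ⟨1, by simp, ?_⟩
    rintro (p | p)
    · simp only [Equiv.Perm.one_apply, mem_Unor_inl]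
      by_cases e1 : p = (x, y)
      · subst e1; simp [hb]
      by_cases e2 : p = (x, y + 1)
      · subst e2; simp [hb]
      rw [h1 p e1 e2]
    · simp only [Equiv.Perm.one_apply, mem_Unor_inr]
      by_cases e1 : p = (x, y)
      · subst e1; simp [hb]
      by_cases e2 : p = (x + 1, y)
      · subst e2; simp [hb]
      rw [h2 p e1 e2]

/-- Conservation of unoriented edges: if a 15-vertex configuration `c'` is
obtained from a 15-vertex configuration `c` by a finite sequence of elementary
moves, then `U(c) \ U(c')` and `U(c') \ U(c)` are finite of equal cardinality;
in particular, if `c` has finitely many unoriented edges then `c'` has exactly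
as many. -/
theorem stmt8 (c c' : Conf)
    (hc : Fifteen c.1 c.2) (hc' : Fifteen c'.1 c'.2)
    (hmoves : Relation.ReflTransGen Move c c') :
    (Unor c \ Unor c').Finite ∧ (Unor c' \ Unor c).Finite ∧
      (Unor c \ Unor c').ncard = (Unor c' \ Unor c).ncard ∧
      ((Unor c).Finite → (Unor c').Finite ∧ (Unor c').ncard = (Unor c).ncard) := by
  have h : PermRel (Unor c) (Unor c') := by
    clear hc hc'
    induction hmoves with
    | refl => exact PermRel.rfl' _
    | tail _ hm ih => exact ih.trans' (PermRel.of_move hm)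
  exact h.concl
end
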